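/- arXiv:2211.04827 — 2 statements merged into one kernel-verified Lean document; each statement's English description precedes it below -/
import Mathlib

section
/- Suppose sequences (x_k), (γ_k), (α_k), (p_k), (Φ_k) are generated by the nonmonotone proximal gradient method with backtracking information, and assume additionally that g is continuous relative to its domain (i.e., the restriction of g to {x : g(x) < ∞} is continuous). Let x* be an accumulation point of (x_k). Then g(x*) < ∞, x* is M-stationary for φ (that is, 0 ∈ ∂φ(x*), equivalently −∇f(x*) ∈ ∂g(x*)), and φ(x*) = φ_*, where φ_* is the common limit of the sequences (Φ_k) and (φ(x_k)). -/
open Filter Topology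
open scoped RealInnerProductSpace

variable {X : Type*} [NormedAddCommGroup X] [InnerProductSpace ℝ X] [FiniteDimensional ℝ X]

/-- The extended-real-valued composite objective `φ = f + g`. -/
noncomputable def phiE (f : X → ℝ) (g : X → EReal) (z : X) : EReal :=
  (f z : EReal) + g z

/-- `y` minimizes `z ↦ g z + ⟪v, z - x⟫ + ‖z - x‖² / (2γ)` over `X`
(a proximal gradient step from `x` with gradient vector `v` and stepsize `γ`). -/
def ProxMin (g : X → EReal) (v x : X) (γ : ℝ) (y : X) : Prop :=
  ∀ z : X,
    g y + ((⟪v, y - x⟫ + ‖y - x‖ ^ 2 / (2 * γ) : ℝ) : EReal) ≤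
      g z + ((⟪v, z - x⟫ + ‖z - x‖ ^ 2 / (2 * γ) : ℝ) : EReal)

/-- Fréchet (regular) subgradient of `h` at `xb`. -/
noncomputable def FSubgrad (h : X → EReal) (xb v : X) : Prop :=
  h xb ≠ ⊤ ∧
    0 ≤ Filter.liminf
        (fun z : X => (h z - h xb - ((⟪v, z - xb⟫ : ℝ) : EReal)) / ((‖z - xb‖ : ℝ) : EReal))
        (𝓝[≠] xb)

/-- Limiting (Mordukhovich) subgradient of `h` at `xb`. -/
noncomputable def MSubgrad (h : X → EReal) (xb v : X) : Prop :=
  h xb ≠ ⊤ ∧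
    ∃ xs vs : ℕ → X,
      Tendsto xs atTop (𝓝 xb) ∧ Tendsto vs atTop (𝓝 v) ∧
        Tendsto (fun j => h (xs j)) atTop (𝓝 (h xb)) ∧ ∀ j, FSubgrad h (xs j) (vs j)

/-- The sequences `x, γ, α, p, Φ` are generated by the nonmonotone proximal gradient
method for `φ = f + g` with parameters `γmax, αmin, αmax, pmin`. -/
structure NMPG (f : X → ℝ) (g : X → EReal) (γmax αmin αmax pmin : ℝ)
    (x : ℕ → X) (γ α p : ℕ → ℝ) (Φ : ℕ → ℝ) : Prop where
  hf : ContDiff ℝ 1 f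
  hg_nebot : ∀ z, g z ≠ ⊥
  hg_proper : ∃ z, g z ≠ ⊤
  hg_lsc : LowerSemicontinuous g
  hg_proxbdd : ∃ γ₀ : ℝ, 0 < γ₀ ∧ ∃ m : ℝ, ∀ z,
    (m : EReal) ≤ g z + ((‖z‖ ^ 2 / (2 * γ₀) : ℝ) : EReal)
  hφ_bdd : ∃ m : ℝ, ∀ z, (m : EReal) ≤ phiE f g z
  hγmax : 0 < γmax
  hαmin : 0 < αmin
  hαα : αmin ≤ αmax
  hαmax : αmax < 1
  hpmin : 0 < pmin
  hpone : pmin ≤ 1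
  hx0 : g (x 0) ≠ ⊤
  hΦ0 : (Φ 0 : EReal) = phiE f g (x 0)
  hγpos : ∀ k, 0 < γ k
  hγle : ∀ k, γ k ≤ γmax
  hαmem : ∀ k, α k ∈ Set.Icc αmin αmax
  hpmem : ∀ k, p k ∈ Set.Icc pmin 1
  hstep : ∀ k : ℕ, ProxMin g (gradient f (x k)) (x k) (γ (k + 1)) (x (k + 1))
  hls : ∀ k : ℕ, phiE f g (x (k + 1)) ≤
      ((Φ k - (1 - α (k + 1)) / (2 * γ (k + 1)) * ‖x (k + 1) - x k‖ ^ 2 : ℝ) : EReal)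
  hΦrec : ∀ k : ℕ, Φ (k + 1) = (1 - p (k + 1)) * Φ k + p (k + 1) * (phiE f g (x (k + 1))).toReal

/-- Backtracking information: for every `k`, either `γ k ≥ γmin`, or the previously
attempted stepsize `σ ∈ [γ k / βmax, γ k / βmin]` was rejected by the line search. -/
def Backtrack (f : X → ℝ) (g : X → EReal) (αmin γmin βmin βmax : ℝ)
    (x : ℕ → X) (γ : ℕ → ℝ) (Φ : ℕ → ℝ) : Prop :=
  ∀ k : ℕ, γmin ≤ γ (k + 1) ∨
    ∃ σ : ℝ, ∃ y : X, γ (k + 1) / βmax ≤ σ ∧ σ ≤ γ (k + 1) / βmin ∧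
      ProxMin g (gradient f (x k)) (x k) σ y ∧
      ((Φ k - (1 - αmin) / (2 * σ) * ‖y - x k‖ ^ 2 : ℝ) : EReal) < phiE f g y

/-- The real-valued form of the line search objective; it agrees with `phiE` on the domain of `g`. -/
noncomputable def phiReal (f : X → ℝ) (g : X → EReal) (z : X) : ℝ :=
  f z + (g z).toReal

omit [NormedAddCommGroup X] [InnerProductSpace ℝ X] [FiniteDimensional ℝ X] in
theorem phiE_eq_coe {f : X → ℝ} {g : X → EReal} {z : X} (hbot : g z ≠ ⊥) (htop : g z ≠ ⊤) :
    phiE f g z = (phiReal f g z : EReal) := by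
  rw [phiE, phiReal, EReal.coe_add, EReal.coe_toReal htop hbot]

omit [NormedAddCommGroup X] [InnerProductSpace ℝ X] [FiniteDimensional ℝ X] in
theorem ne_top_of_phiE_le_coe {f : X → ℝ} {g : X → EReal} {z : X} {r : ℝ}
    (hle : phiE f g z ≤ (r : EReal)) : g z ≠ ⊤ := by
  intro htop
  rw [phiE, htop, EReal.coe_add_top, top_le_iff] at hle
  exact EReal.coe_ne_top r hle

omit [FiniteDimensional ℝ X] in
theorem ProxMin.ne_top {g : X → EReal} {v x y z : X} {σ : ℝ} (hy : ProxMin g v x σ y)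
    (hz : g z ≠ ⊤) : g y ≠ ⊤ := by
  intro htop
  have hle := hy z
  rw [htop, EReal.top_add_coe, top_le_iff] at hle
  exact EReal.add_ne_top hz (EReal.coe_ne_top _) hle

omit [FiniteDimensional ℝ X] in
theorem ProxMin.toReal_le {g : X → EReal} {v x y z : X} {σ : ℝ} (hy : ProxMin g v x σ y)
    (hbot : ∀ z, g z ≠ ⊥) (hz : g z ≠ ⊤) :
    (g y).toReal + (⟪v, y - x⟫ + ‖y - x‖ ^ 2 / (2 * σ)) ≤
      (g z).toReal + (⟪v, z - x⟫ + ‖z - x‖ ^ 2 / (2 * σ)) := by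
  have hle := hy z
  rw [← EReal.coe_toReal hz (hbot z), ← EReal.coe_toReal (hy.ne_top hz) (hbot y)] at hle
  exact_mod_cast hle

omit [FiniteDimensional ℝ X] in
theorem ProxMin.toReal_le_base {g : X → EReal} {v x y : X} {σ : ℝ} (hy : ProxMin g v x σ y)
    (hbot : ∀ z, g z ≠ ⊥) (hx : g x ≠ ⊤) :
    (g y).toReal + (⟪v, y - x⟫ + ‖y - x‖ ^ 2 / (2 * σ)) ≤ (g x).toReal := by
  simpa only [sub_self, inner_zero_right, norm_zero, ne_eq, OfNat.ofNat_ne_zero,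
    not_false_eq_true, zero_pow, zero_div, add_zero] using hy.toReal_le hbot hx

/-- The optimality condition of a proximal gradient step, as a Fréchet subgradient of `f + g`. -/
theorem ProxMin.fsubgrad_phiE {f : X → ℝ} {g : X → EReal} {w x y : X} {σ : ℝ}
    (hy : ProxMin g w x σ y) (hσ : 0 < σ) (hbot : ∀ z, g z ≠ ⊥) (hytop : g y ≠ ⊤)
    (hf : DifferentiableAt ℝ f y) :
    FSubgrad (phiE f g) y (gradient f y - w - σ⁻¹ • (y - x)) := by
  have hφy := phiE_eq_coe (f := f) (hbot y) hytop
  refine ⟨by rw [hφy]; exact EReal.coe_ne_top _, ?_⟩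
  rw [Filter.le_liminf_iff]
  intro a ha
  obtain ⟨r, har, hr⟩ := EReal.lt_iff_exists_real_btwn.1 ha
  replace hr : r < 0 := by exact_mod_cast hr
  have hlin := hf.hasGradientAt.hasFDerivAt.isLittleO.def (c := -r / 2) (by linarith)
  have hball := Metric.ball_mem_nhds y (show 0 < -r * σ by nlinarith)
  filter_upwards [nhdsWithin_le_nhds hlin, nhdsWithin_le_nhds hball, self_mem_nhdsWithin]
    with z hz hzball hzy
  refine har.trans_le ?_
  have hd : 0 < ‖z - y‖ := norm_pos_iff.2 (sub_ne_zero.2 hzy)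
  rw [EReal.le_div_iff_mul_le (by exact_mod_cast hd) (EReal.coe_ne_top _), hφy]
  by_cases hztop : g z = ⊤
  · rw [phiE, hztop, EReal.coe_add_top, EReal.top_sub_coe, EReal.top_sub_coe]
    exact le_top
  rw [phiE_eq_coe (hbot z) hztop]
  norm_cast
  have hprox := hy.toReal_le hbot hztop
  rw [mem_ball_iff_norm] at hzball
  rw [Real.norm_eq_abs] at hz
  have hfz := (abs_le.1 hz).1
  simp only [InnerProductSpace.toDual_apply_apply] at hfz
  have hsplit : z - x = (z - y) + (y - x) := by abel
  rw [hsplit, norm_add_sq_real, inner_add_right] at hprox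
  have hquad : ‖z - y‖ ^ 2 / (2 * σ) ≤ -r / 2 * ‖z - y‖ := by
    rw [div_le_iff₀ (by positivity)]
    nlinarith
  have hexp : (‖z - y‖ ^ 2 + 2 * ⟪z - y, y - x⟫ + ‖y - x‖ ^ 2) / (2 * σ) =
      ‖z - y‖ ^ 2 / (2 * σ) + σ⁻¹ * ⟪y - x, z - y⟫ + ‖y - x‖ ^ 2 / (2 * σ) := by
    rw [real_inner_comm (y - x) (z - y)]
    field_simp
  rw [hexp] at hprox
  rw [inner_sub_left, inner_sub_left, real_inner_smul_left, phiReal, phiReal]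
  linarith

theorem sq_le_of_sq_div_le {d σ γ A B R : ℝ} (hσ : 0 < σ) (hγ : 0 < γ) (hσγ : σ ≤ γ / 4)
    (hle : d ^ 2 / (2 * σ) ≤ A + B * d + (R ^ 2 + d ^ 2) / γ) :
    d ^ 2 ≤ 8 * σ * (A + R ^ 2 / γ) + 16 * σ ^ 2 * B ^ 2 := by
  rw [div_le_iff₀ (by positivity), add_div] at hle
  have hquad : d ^ 2 / γ * (2 * σ) ≤ d ^ 2 / 2 := by
    rw [div_mul_eq_mul_div, div_le_iff₀ hγ]
    nlinarith [sq_nonneg d]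
  nlinarith [sq_nonneg (d - 4 * σ * B)]

omit [FiniteDimensional ℝ X] in
/-- A proximal gradient step from a point with controlled data is short if the stepsize is small. -/
theorem ProxMin.norm_sub_sq_le {g : X → EReal} {v x y : X} {σ γ₀ m c B R : ℝ}
    (hy : ProxMin g v x σ y) (hbot : ∀ z, g z ≠ ⊥) (hγ₀ : 0 < γ₀)
    (hm : ∀ z, (m : EReal) ≤ g z + ((‖z‖ ^ 2 / (2 * γ₀) : ℝ) : EReal))
    (hx : g x ≠ ⊤) (hσ : 0 < σ) (hσγ : σ ≤ γ₀ / 4) (hc : (g x).toReal ≤ c)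
    (hB : ‖v‖ ≤ B) (hR : ‖x‖ ≤ R) :
    ‖y - x‖ ^ 2 ≤ 8 * σ * (c - m + R ^ 2 / γ₀) + 16 * σ ^ 2 * B ^ 2 := by
  refine sq_le_of_sq_div_le hσ hγ₀ hσγ ?_
  have hprox := hy.toReal_le_base hbot hx
  have hmy := hm y
  rw [← EReal.coe_toReal (hy.ne_top hx) (hbot y)] at hmy
  norm_cast at hmy
  have hinner : -(B * ‖y - x‖) ≤ ⟪v, y - x⟫ := by
    have := (abs_le.1 (abs_real_inner_le_norm v (y - x))).1
    nlinarith [norm_nonneg (y - x)]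
  have hynorm : ‖y‖ ^ 2 / (2 * γ₀) ≤ (R ^ 2 + ‖y - x‖ ^ 2) / γ₀ := by
    have htri : ‖y‖ ≤ R + ‖y - x‖ := by
      calc ‖y‖ = ‖x + (y - x)‖ := by congr 1; abel
        _ ≤ ‖x‖ + ‖y - x‖ := norm_add_le _ _
        _ ≤ R + ‖y - x‖ := by gcongr
    rw [div_le_div_iff₀ (by positivity) hγ₀]
    have : ‖y‖ ^ 2 ≤ 2 * (R ^ 2 + ‖y - x‖ ^ 2) := by
      nlinarith [sq_nonneg (R - ‖y - x‖), norm_nonneg y]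
    nlinarith
  linarith

section NMPG

variable {f : X → ℝ} {g : X → EReal} {γmax αmin αmax pmin : ℝ} {x : ℕ → X}
  {γ α p Φ : ℕ → ℝ}

theorem NMPG.ne_top (h : NMPG f g γmax αmin αmax pmin x γ α p Φ) (k : ℕ) : g (x k) ≠ ⊤ := by
  cases k with
  | zero => exact h.hx0
  | succ k => exact ne_top_of_phiE_le_coe (h.hls k)

theorem NMPG.phiE_eq (h : NMPG f g γmax αmin αmax pmin x γ α p Φ) (k : ℕ) :
    phiE f g (x k) = (phiReal f g (x k) : EReal) :=
  phiE_eq_coe (h.hg_nebot _) (h.ne_top k)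

theorem NMPG.phiReal_succ_le (h : NMPG f g γmax αmin αmax pmin x γ α p Φ) (k : ℕ) :
    phiReal f g (x (k + 1)) ≤
      Φ k - (1 - α (k + 1)) / (2 * γ (k + 1)) * ‖x (k + 1) - x k‖ ^ 2 := by
  have hls := h.hls k
  rw [h.phiE_eq] at hls
  exact_mod_cast hls

theorem NMPG.phi_succ_eq (h : NMPG f g γmax αmin αmax pmin x γ α p Φ) (k : ℕ) :
    Φ (k + 1) = (1 - p (k + 1)) * Φ k + p (k + 1) * phiReal f g (x (k + 1)) := by
  rw [h.hΦrec k, h.phiE_eq, EReal.toReal_coe]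

theorem NMPG.decrease_nonneg (h : NMPG f g γmax αmin αmax pmin x γ α p Φ) (k : ℕ) :
    0 ≤ (1 - α (k + 1)) / (2 * γ (k + 1)) * ‖x (k + 1) - x k‖ ^ 2 := by
  have hα : 0 ≤ 1 - α (k + 1) := by linarith [(h.hαmem (k + 1)).2, h.hαmax]
  have hγ := h.hγpos (k + 1)
  positivity

theorem NMPG.phiReal_le (h : NMPG f g γmax αmin αmax pmin x γ α p Φ) (k : ℕ) :
    phiReal f g (x k) ≤ Φ k := by
  cases k with
  | zero =>
    have h0 := h.hΦ0
    rw [h.phiE_eq] at h0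
    exact (EReal.coe_injective h0).ge
  | succ k =>
    rw [h.phi_succ_eq k]
    nlinarith [(h.hpmem (k + 1)).2, h.phiReal_succ_le k, h.decrease_nonneg k]

theorem NMPG.p_pos (h : NMPG f g γmax αmin αmax pmin x γ α p Φ) (k : ℕ) : 0 < p k :=
  h.hpmin.trans_le (h.hpmem k).1

theorem NMPG.antitone (h : NMPG f g γmax αmin αmax pmin x γ α p Φ) : Antitone Φ := by
  refine antitone_nat_of_succ_le fun k => ?_
  rw [h.phi_succ_eq k]
  nlinarith [h.p_pos (k + 1), h.phiReal_succ_le k, h.decrease_nonneg k]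

theorem NMPG.exists_tendsto (h : NMPG f g γmax αmin αmax pmin x γ α p Φ) :
    ∃ φstar : ℝ, Tendsto Φ atTop (𝓝 φstar) := by
  obtain ⟨m, hm⟩ := h.hφ_bdd
  refine ⟨_, tendsto_atTop_ciInf h.antitone ⟨m, ?_⟩⟩
  rintro _ ⟨k, rfl⟩
  have hmk := hm (x k)
  rw [h.phiE_eq] at hmk
  exact (EReal.coe_le_coe_iff.1 hmk).trans (h.phiReal_le k)

theorem NMPG.tendsto_sub_phiReal (h : NMPG f g γmax αmin αmax pmin x γ α p Φ) :
    Tendsto (fun k => Φ k - phiReal f g (x (k + 1))) atTop (𝓝 0) := by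
  obtain ⟨φstar, hΦ⟩ := h.exists_tendsto
  have hdiff : Tendsto (fun k => (Φ k - Φ (k + 1)) / pmin) atTop (𝓝 0) := by
    simpa using (hΦ.sub (hΦ.comp (tendsto_add_atTop_nat 1))).div_const pmin
  refine squeeze_zero (fun k => ?_) (fun k => ?_) hdiff
  · linarith [h.phiReal_succ_le k, h.decrease_nonneg k]
  · rw [le_div_iff₀ h.hpmin, h.phi_succ_eq k]
    nlinarith [(h.hpmem (k + 1)).1, h.phiReal_succ_le k, h.decrease_nonneg k]

theorem NMPG.tendsto_phiReal (h : NMPG f g γmax αmin αmax pmin x γ α p Φ) {φstar : ℝ}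
    (hΦ : Tendsto Φ atTop (𝓝 φstar)) :
    Tendsto (fun k => phiReal f g (x k)) atTop (𝓝 φstar) := by
  rw [← tendsto_add_atTop_iff_nat 1]
  simpa using hΦ.sub h.tendsto_sub_phiReal

theorem NMPG.tendsto_norm_sub (h : NMPG f g γmax αmin αmax pmin x γ α p Φ) :
    Tendsto (fun k => ‖x (k + 1) - x k‖) atTop (𝓝 0) := by
  have hαmax : 0 < 1 - αmax := by linarith [h.hαmax]
  have hγmax := h.hγmax
  have hlim : Tendsto (fun k => √((Φ k - phiReal f g (x (k + 1))) / ((1 - αmax) / (2 * γmax))))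
      atTop (𝓝 0) := by
    simpa using (h.tendsto_sub_phiReal.div_const ((1 - αmax) / (2 * γmax))).sqrt
  refine squeeze_zero (fun k => norm_nonneg _) (fun k => Real.le_sqrt_of_sq_le ?_) hlim
  rw [le_div_iff₀ (by positivity), mul_comm]
  have hγ := h.hγpos (k + 1)
  have hcoef : (1 - αmax) / (2 * γmax) ≤ (1 - α (k + 1)) / (2 * γ (k + 1)) := by
    have hα := (h.hαmem (k + 1)).2
    have hγle := h.hγle (k + 1)
    gcongr
    linarith
  have := mul_le_mul_of_nonneg_right hcoef (sq_nonneg ‖x (k + 1) - x k‖)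
  linarith [h.phiReal_succ_le k]

/-- A rejected trial step is bounded by the linearization error of `f`. -/
theorem NMPG.norm_sub_sq_lt_of_rejected (h : NMPG f g γmax αmin αmax pmin x γ α p Φ) {k : ℕ}
    {σ : ℝ} {y : X} (hy : ProxMin g (gradient f (x k)) (x k) σ y)
    (hrej : ((Φ k - (1 - αmin) / (2 * σ) * ‖y - x k‖ ^ 2 : ℝ) : EReal) < phiE f g y) :
    αmin / (2 * σ) * ‖y - x k‖ ^ 2 < f y - f (x k) - ⟪gradient f (x k), y - x k⟫ := by
  rw [phiE_eq_coe (h.hg_nebot y) (hy.ne_top (h.ne_top k)), EReal.coe_lt_coe_iff] at hrej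
  have hprox := hy.toReal_le_base h.hg_nebot (h.ne_top k)
  have hφ := h.phiReal_le k
  rw [phiReal] at hφ hrej
  have hsplit : (1 - αmin) / (2 * σ) * ‖y - x k‖ ^ 2 =
      ‖y - x k‖ ^ 2 / (2 * σ) - αmin / (2 * σ) * ‖y - x k‖ ^ 2 := by ring
  linarith

omit [FiniteDimensional ℝ X] in
theorem continuous_gradient_of_contDiff [CompleteSpace X] (hf : ContDiff ℝ 1 f) :
    Continuous (gradient f) :=
  (InnerProductSpace.toDual ℝ X).symm.continuous.comp (hf.continuous_fderiv one_ne_zero)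

/-- Near an accumulation point there are points with small Fréchet subgradients of `f + g`. -/
theorem NMPG.exists_fsubgrad_near (h : NMPG f g γmax αmin αmax pmin x γ α p Φ)
    {γmin βmin βmax : ℝ} (hγmin : 0 < γmin) (hβmin : 0 < βmin) (hββ : βmin ≤ βmax)
    (hbt : Backtrack f g αmin γmin βmin βmax x γ Φ) {xstar : X}
    (hacc : MapClusterPt xstar atTop x) {ε : ℝ} (hε : 0 < ε) :
    ∃ z v, g z ≠ ⊤ ∧ ‖z - xstar‖ < ε ∧ ‖v‖ < ε ∧ FSubgrad (phiE f g) z v := by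
  have hgrad := continuous_gradient_of_contDiff h.hf
  have hdiff : Differentiable ℝ f := h.hf.differentiable one_ne_zero
  have hαmin := h.hαmin
  obtain ⟨γ₀, hγ₀, m, hm⟩ := h.hg_proxbdd
  set τ := min (ε / 8) (αmin * ε / 16) with hτdef
  have hτ : 0 < τ := by positivity
  have hτε : τ ≤ ε / 8 := min_le_left _ _
  have hτα : τ ≤ αmin * ε / 16 := min_le_right _ _
  have hstrict : HasStrictFDerivAt f (fderiv ℝ f xstar) xstar :=
    h.hf.contDiffAt.hasStrictFDerivAt one_ne_zero
  obtain ⟨ρ₁, hρ₁, hlin⟩ := Metric.eventually_nhds_iff_ball.1 (hstrict.isLittleO.def hτ)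
  obtain ⟨ρ₂, hρ₂, hgradball⟩ := Metric.continuous_iff.1 hgrad xstar τ hτ
  set η := min (ε / 2) (min (ρ₁ / 2) (ρ₂ / 2)) with hηdef
  have hη : 0 < η := by positivity
  have hηε : η ≤ ε / 2 := min_le_left _ _
  have hηρ₁ : η ≤ ρ₁ / 2 := (min_le_right _ _).trans (min_le_left _ _)
  have hηρ₂ : η ≤ ρ₂ / 2 := (min_le_right _ _).trans (min_le_right _ _)
  set c := Φ 0 - f xstar + 1
  set B := ‖gradient f xstar‖ + τ
  set R := ‖xstar‖ + η
  have hsmall : ∀ᶠ σ : ℝ in 𝓝 0,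
      8 * σ * (c - m + R ^ 2 / γ₀) + 16 * σ ^ 2 * B ^ 2 < η ^ 2 ∧ σ < γ₀ / 4 := by
    refine Filter.Eventually.and ?_ (gt_mem_nhds (by positivity))
    have hcont : Continuous fun σ : ℝ =>
        8 * σ * (c - m + R ^ 2 / γ₀) + 16 * σ ^ 2 * B ^ 2 := by fun_prop
    refine hcont.tendsto 0 |>.eventually (gt_mem_nhds ?_)
    simpa using pow_pos hη 2
  obtain ⟨σ₀, hσ₀, hσball⟩ := Metric.eventually_nhds_iff.1 hsmall
  set γlow := min γmin (βmin * σ₀)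
  have hγlow : 0 < γlow := by positivity
  have hnear : ∀ᶠ z in 𝓝 xstar, ‖z - xstar‖ < η ∧ f z > f xstar - 1 := by
    refine Filter.Eventually.and ?_ (hdiff.continuous.tendsto xstar |>.eventually
      (lt_mem_nhds (by linarith)))
    filter_upwards [Metric.ball_mem_nhds xstar hη] with z hz
    exact mem_ball_iff_norm.1 hz
  have hlate : ∀ᶠ k in atTop, ‖x (k + 1) - x k‖ < min η (τ * γlow) :=
    h.tendsto_norm_sub.eventually (gt_mem_nhds (by positivity))
  obtain ⟨k, ⟨hxk, hfk⟩, hΔ⟩ := ((hacc.frequently hnear).and_eventually hlate).exists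
  -- A proximal gradient step from `x k` of small normalized length has the desired properties.
  have hstep : ∀ (σ : ℝ) (z : X), 0 < σ → ProxMin g (gradient f (x k)) (x k) σ z →
      ‖z - x k‖ < η → ‖z - x k‖ ≤ ε / 4 * σ →
      ∃ z v, g z ≠ ⊤ ∧ ‖z - xstar‖ < ε ∧ ‖v‖ < ε ∧ FSubgrad (phiE f g) z v := by
    intro σ z hσ hz hzη hzσ
    have hztop := hz.ne_top (h.ne_top k)
    have hzstar : ‖z - xstar‖ < 2 * η := by
      calc ‖z - xstar‖ ≤ ‖z - x k‖ + ‖x k - xstar‖ := norm_sub_le_norm_sub_add_norm_sub _ _ _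
        _ < 2 * η := by linarith
    refine ⟨z, _, hztop, by linarith, ?_, hz.fsubgrad_phiE hσ h.hg_nebot hztop (hdiff z)⟩
    have hgz := hgradball z (by rw [dist_eq_norm]; linarith)
    have hgx := hgradball (x k) (by rw [dist_eq_norm]; linarith)
    have hgg : ‖gradient f z - gradient f (x k)‖ < 2 * τ := by
      rw [← dist_eq_norm]
      linarith [dist_triangle_right (gradient f z) (gradient f (x k)) (gradient f xstar)]
    have hquot : ‖σ⁻¹ • (z - x k)‖ ≤ ε / 4 := by
      rw [norm_smul, norm_inv, Real.norm_of_nonneg hσ.le, inv_mul_le_iff₀ hσ]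
      linarith
    linarith [norm_sub_le (gradient f z - gradient f (x k)) (σ⁻¹ • (z - x k))]
  have hγk := h.hγpos (k + 1)
  by_cases hγ : γlow ≤ γ (k + 1)
  · refine hstep (γ (k + 1)) (x (k + 1)) hγk (h.hstep k) (hΔ.trans_le (min_le_left _ _)) ?_
    calc ‖x (k + 1) - x k‖ ≤ τ * γlow := hΔ.le.trans (min_le_right _ _)
      _ ≤ ε / 4 * γ (k + 1) := by gcongr; linarith
  push Not at hγ
  rcases hbt k with hge | ⟨σ, y, hσlow, hσup, hy, hrej⟩
  · exact absurd (hge.trans_lt (hγ.trans_le (min_le_left _ _))) (lt_irrefl _)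
  have hσ : 0 < σ := (div_pos hγk (hβmin.trans_le hββ)).trans_le hσlow
  have hσσ₀ : σ < σ₀ := by
    refine hσup.trans_lt ?_
    rw [div_lt_iff₀ hβmin, mul_comm]
    exact hγ.trans_le (min_le_right _ _)
  obtain ⟨hσsq, hσγ₀⟩ := hσball (y := σ)
    (by rwa [Real.dist_eq, sub_zero, abs_of_pos hσ])
  have hxstar : dist (x k) xstar < ρ₂ := by rw [dist_eq_norm]; linarith
  have hyη : ‖y - x k‖ < η := by
    refine lt_of_pow_lt_pow_left₀ 2 hη.le (lt_of_le_of_lt ?_ hσsq)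
    refine hy.norm_sub_sq_le h.hg_nebot hγ₀ hm (h.ne_top k) hσ hσγ₀.le ?_ ?_ ?_
    · have := (h.phiReal_le k).trans (h.antitone (Nat.zero_le k))
      rw [phiReal] at this
      linarith
    · have := hgradball (x k) hxstar
      rw [dist_eq_norm] at this
      linarith [norm_le_norm_add_norm_sub' (gradient f (x k)) (gradient f xstar)]
    · linarith [norm_le_norm_add_norm_sub' (x k) xstar]
  refine hstep σ y hσ hy hyη ?_
  have hystar : ‖y - xstar‖ < ρ₁ := by
    linarith [norm_sub_le_norm_sub_add_norm_sub y (x k) xstar]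
  have hyx := hlin (y, x k) (by
    rw [Metric.mem_ball, Prod.dist_eq, max_lt_iff, dist_eq_norm, dist_eq_norm]
    exact ⟨hystar, by linarith⟩)
  rw [Real.norm_eq_abs] at hyx
  have hyx := (abs_le.1 hyx).2
  have hinner : fderiv ℝ f xstar (y - x k) = ⟪gradient f xstar, y - x k⟫ := by
    rw [gradient, InnerProductSpace.toDual_symm_apply]
  have hgerr : ⟪gradient f xstar, y - x k⟫ - ⟪gradient f (x k), y - x k⟫ ≤ τ * ‖y - x k‖ := by
    rw [← inner_sub_left]
    refine (real_inner_le_norm _ _).trans ?_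
    have := hgradball (x k) hxstar
    rw [dist_eq_norm, norm_sub_rev] at this
    gcongr
  have hlt := h.norm_sub_sq_lt_of_rejected hy hrej
  simp only [hinner] at hyx
  have hmain : αmin / (2 * σ) * ‖y - x k‖ ^ 2 < 2 * τ * ‖y - x k‖ := by linarith
  have hpos : 0 < ‖y - x k‖ := by
    rcases (norm_nonneg (y - x k)).eq_or_lt with h0 | h0
    · simp [← h0] at hmain
    · exact h0
  have hmain' : αmin / (2 * σ) * ‖y - x k‖ < 2 * τ := by
    refine lt_of_mul_lt_mul_right ?_ hpos.le
    linarith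
  rw [div_mul_eq_mul_div, div_lt_iff₀ (by positivity)] at hmain'
  nlinarith

end NMPG

theorem stmt_7 (f : X → ℝ) (g : X → EReal) (γmax αmin αmax pmin : ℝ)
    (x : ℕ → X) (γ α p : ℕ → ℝ) (Φ : ℕ → ℝ)
    (h : NMPG f g γmax αmin αmax pmin x γ α p Φ)
    (γmin βmin βmax : ℝ) (hγmin : 0 < γmin) (hβmin : 0 < βmin)
    (hββ : βmin ≤ βmax) (hβmax : βmax < 1)
    (hbt : Backtrack f g αmin γmin βmin βmax x γ Φ)
    (hgcont : ContinuousOn g {z : X | g z ≠ ⊤})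
    (xstar : X) (ks : ℕ → ℕ) (hks : StrictMono ks)
    (hconv : Tendsto (fun j => x (ks j)) atTop (𝓝 xstar)) :
    g xstar ≠ ⊤ ∧ MSubgrad (phiE f g) xstar 0 ∧
      ∃ φstar : ℝ, Tendsto Φ atTop (𝓝 φstar) ∧
        Tendsto (fun k => phiE f g (x k)) atTop (𝓝 (φstar : EReal)) ∧
        phiE f g xstar = (φstar : EReal) := by
  obtain ⟨φstar, hΦ⟩ := h.exists_tendsto
  have hφ := h.tendsto_phiReal hΦ
  have hf : Continuous f := h.hf.continuous
  have hsub := hks.tendsto_atTop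
  have htop : g xstar ≠ ⊤ := by
    intro hgtop
    have hfx := (hf.tendsto xstar).comp hconv
    have hG : Tendsto (fun j => (g (x (ks j))).toReal) atTop (𝓝 (φstar - f xstar)) := by
      have := (hφ.comp hsub).sub hfx
      simpa [Function.comp_def, phiReal] using this
    have hlt : ((φstar - f xstar + 1 : ℝ) : EReal) < g xstar := hgtop ▸ EReal.coe_lt_top _
    have hlarge := hconv.eventually (h.hg_lsc xstar _ hlt)
    obtain ⟨j, hj, hj'⟩ := (hlarge.and (hG.eventually (gt_mem_nhds
      (show φstar - f xstar < φstar - f xstar + 1 by linarith)))).exists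
    rw [← EReal.coe_toReal (h.ne_top (ks j)) (h.hg_nebot _), gt_iff_lt, EReal.coe_lt_coe_iff] at hj
    exact lt_asymm hj hj'
  have hcont : ∀ z : ℕ → X, (∀ j, g (z j) ≠ ⊤) → Tendsto z atTop (𝓝 xstar) →
      Tendsto (fun j => phiE f g (z j)) atTop (𝓝 (phiE f g xstar)) := by
    intro z hz hlim
    have hgz : Tendsto (fun j => g (z j)) atTop (𝓝 (g xstar)) :=
      (hgcont xstar htop).tendsto.comp
        (tendsto_nhdsWithin_iff.2 ⟨hlim, Eventually.of_forall hz⟩)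
    have hfz : Tendsto (fun j => (f (z j) : EReal)) atTop (𝓝 (f xstar : EReal)) :=
      (continuous_coe_real_ereal.tendsto _).comp ((hf.tendsto xstar).comp hlim)
    exact (EReal.continuousAt_add (Or.inl (EReal.coe_ne_top _))
      (Or.inl (EReal.coe_ne_bot _))).tendsto.comp (hfz.prodMk_nhds hgz)
  have hφE : Tendsto (fun k => phiE f g (x k)) atTop (𝓝 (φstar : EReal)) := by
    simp only [h.phiE_eq]
    exact (continuous_coe_real_ereal.tendsto _).comp hφ
  refine ⟨htop, ⟨?_, ?_⟩, φstar, hΦ, hφE, ?_⟩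
  · rw [phiE_eq_coe (h.hg_nebot _) htop]
    exact EReal.coe_ne_top _
  · have hacc : MapClusterPt xstar atTop x := hconv.mapClusterPt.of_comp hsub
    choose z v hz hzx hv hzv using fun n : ℕ =>
      h.exists_fsubgrad_near hγmin hβmin hββ hbt hacc (ε := 1 / ((n : ℝ) + 1)) (by positivity)
    have hlim : Tendsto z atTop (𝓝 xstar) :=
      tendsto_iff_norm_sub_tendsto_zero.2 (squeeze_zero (fun _ => norm_nonneg _)
        (fun n => (hzx n).le) tendsto_one_div_add_atTop_nhds_zero_nat)
    exact ⟨z, v, hlim, squeeze_zero_norm (fun n => (hv n).le)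
      tendsto_one_div_add_atTop_nhds_zero_nat, hcont z hz hlim, hzv⟩
  · exact tendsto_nhds_unique (hcont _ (fun j => h.ne_top (ks j)) hconv) (hφE.comp hsub)
end

section
/- Suppose sequences (x_k), (γ_k), (α_k), (p_k), (Φ_k) are generated by the nonmonotone proximal gradient method with backtracking information, and let ε > 0. If the sequence (x_k) admits at least one accumulation point, then there exists k ≥ 1 such that ‖(1/γ_k)(x_{k−1} − x_k) − ∇f(x_{k−1}) + ∇f(x_k)‖ ≤ ε (i.e., the termination criterion of the method is satisfied after finitely many iterations). -/
open Filter Topology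
open scoped RealInnerProductSpace

variable {X : Type*} [NormedAddCommGroup X] [InnerProductSpace ℝ X] [FiniteDimensional ℝ X]

theorem ProxMin.le_toReal {g : X → EReal} (hbot : ∀ z, g z ≠ ⊥) {v x y : X} {σ : ℝ}
    (hy : ProxMin g v x σ y) {z : X} (hz : g z ≠ ⊤) :
    g y ≠ ⊤ ∧ (g y).toReal + (⟪v, y - x⟫ + ‖y - x‖ ^ 2 / (2 * σ)) ≤
      (g z).toReal + (⟪v, z - x⟫ + ‖z - x‖ ^ 2 / (2 * σ)) := by
  have h := hy z
  have hz' := EReal.coe_toReal hz (hbot z)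
  have htop : g y ≠ ⊤ := by
    intro h1
    rw [h1, ← hz', ← EReal.coe_add, EReal.top_add_coe] at h
    exact absurd h (not_le.2 (EReal.coe_lt_top _))
  refine ⟨htop, ?_⟩
  rw [← hz', ← EReal.coe_toReal htop (hbot y), ← EReal.coe_add, ← EReal.coe_add] at h
  exact EReal.coe_le_coe_iff.1 h

/-- The displacement of a proximal gradient step is nondecreasing in the stepsize. -/
theorem ProxMin.norm_sub_le {g : X → EReal} (hbot : ∀ z, g z ≠ ⊥) {v x y z : X} {γ σ : ℝ}
    (hγ : 0 < γ) (hγσ : γ < σ) (hz : ProxMin g v x γ z) (hy : ProxMin g v x σ y)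
    (hgz : g z ≠ ⊤) : ‖z - x‖ ≤ ‖y - x‖ := by
  obtain ⟨hgy, h1⟩ := hy.le_toReal hbot hgz
  obtain ⟨-, h2⟩ := hz.le_toReal hbot hgy
  have hinv : 1 / (2 * σ) < 1 / (2 * γ) := one_div_lt_one_div_of_lt (by linarith) (by linarith)
  simp only [div_eq_mul_one_div (_ ^ 2)] at h1 h2
  by_contra! hlt
  have : ‖y - x‖ ^ 2 < ‖z - x‖ ^ 2 := by gcongr
  nlinarith

/-- Proximal gradient steps with small stepsizes, from bounded points with bounded gradients
and bounded function values, move only a little. -/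
theorem exists_stepsize_norm_sub_lt {g : X → EReal} (hbot : ∀ z, g z ≠ ⊥) {γ₀ m : ℝ}
    (hγ₀ : 0 < γ₀) (hm : ∀ z, (m : EReal) ≤ g z + ((‖z‖ ^ 2 / (2 * γ₀) : ℝ) : EReal))
    (A V R : ℝ) {δ : ℝ} (hδ : 0 < δ) :
    ∃ σ₀ > 0, ∀ σ, 0 < σ → σ < σ₀ → ∀ v x y : X, ‖v‖ ≤ V → ‖x‖ ≤ R → g x ≠ ⊤ →
      (g x).toReal ≤ A → ProxMin g v x σ y → ‖y - x‖ < δ := by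
  set C := A - m + R ^ 2 / γ₀ + V ^ 2 / 2 with hC
  set K := (|C| + 1) / δ ^ 2 with hK
  have hKpos : 0 < K := by positivity
  refine ⟨1 / (2 * (1 / γ₀ + 1 / 2 + K)), by positivity, ?_⟩
  intro σ hσ hσ₀ v x y hv hx hgx hA hy
  obtain ⟨hgy, h1⟩ := hy.le_toReal hbot hgx
  have h2 := hm y
  rw [← EReal.coe_toReal hgy (hbot y), ← EReal.coe_add, EReal.coe_le_coe_iff] at h2
  have hσ' : 1 / γ₀ + 1 / 2 + K ≤ 1 / (2 * σ) := by
    rw [lt_div_iff₀ (by positivity)] at hσ₀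
    rw [le_div_iff₀ (by positivity)]
    linarith
  have h3 : -(V ^ 2 / 2 + ‖y - x‖ ^ 2 / 2) ≤ ⟪v, y - x⟫ := by
    have := neg_le_of_abs_le (abs_real_inner_le_norm v (y - x))
    nlinarith [sq_nonneg (‖v‖ - ‖y - x‖), norm_nonneg v]
  have h4 : ‖y‖ ^ 2 ≤ 2 * R ^ 2 + 2 * ‖y - x‖ ^ 2 := by
    have : ‖y‖ ≤ R + ‖y - x‖ := by
      have := norm_add_le x (y - x)
      rw [add_sub_cancel] at this
      linarith
    nlinarith [sq_nonneg (R - ‖y - x‖), norm_nonneg y]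
  have h5 : ‖y‖ ^ 2 / (2 * γ₀) ≤ R ^ 2 / γ₀ + ‖y - x‖ ^ 2 * (1 / γ₀) := by
    calc ‖y‖ ^ 2 / (2 * γ₀) ≤ (2 * R ^ 2 + 2 * ‖y - x‖ ^ 2) / (2 * γ₀) := by gcongr
      _ = _ := by field_simp
  simp only [sub_self, inner_zero_right, norm_zero, ne_eq, OfNat.ofNat_ne_zero,
    not_false_eq_true, zero_pow, zero_div, add_zero] at h1
  rw [div_eq_mul_one_div] at h1
  have h6 : ‖y - x‖ ^ 2 * (1 / γ₀ + 1 / 2 + K) ≤ ‖y - x‖ ^ 2 * (1 / (2 * σ)) := by gcongr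
  have h7 : ‖y - x‖ ^ 2 * K ≤ C := by rw [hC]; linarith
  have h8 : C < δ ^ 2 * K := by
    rw [hK, mul_div_cancel₀ _ (by positivity)]
    linarith [le_abs_self C]
  exact lt_of_pow_lt_pow_left₀ 2 hδ.le (lt_of_mul_lt_mul_right (h7.trans_lt h8) hKpos.le)

theorem ContDiff.continuous_gradient_of_one {f : X → ℝ} (hf : ContDiff ℝ 1 f) :
    Continuous (gradient f) :=
  (InnerProductSpace.toDual ℝ X).symm.continuous.comp (hf.continuous_fderiv one_ne_zero)

theorem sub_inner_gradient_le {f : X → ℝ} (hf : ContDiff ℝ 1 f) {s : Set X} (hs : Convex ℝ s)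
    {C : ℝ} {x y : X} (hx : x ∈ s) (hy : y ∈ s)
    (hC : ∀ z ∈ s, ‖gradient f z - gradient f x‖ ≤ C) :
    f y - f x - ⟪gradient f x, y - x⟫ ≤ C * ‖y - x‖ := by
  have hd (z : X) : HasFDerivAt f (InnerProductSpace.toDual ℝ X (gradient f z)) z :=
    ((hf.differentiable one_ne_zero) z).hasGradientAt.hasFDerivAt
  have := hs.norm_image_sub_le_of_norm_hasFDerivWithin_le'
    (φ := InnerProductSpace.toDual ℝ X (gradient f x))
    (fun z _ => (hd z).hasFDerivWithinAt)
    (fun z hz => by rw [← map_sub, LinearIsometryEquiv.norm_map]; exact hC z hz) hx hy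
  rw [InnerProductSpace.toDual_apply_apply] at this
  exact (le_abs_self _).trans this

namespace NMPG

variable {f : X → ℝ} {g : X → EReal} {γmax αmin αmax pmin : ℝ}
  {x : ℕ → X} {γ α p : ℕ → ℝ} {Φ : ℕ → ℝ}

theorem g_ne_top (h : NMPG f g γmax αmin αmax pmin x γ α p Φ) (k : ℕ) : g (x k) ≠ ⊤ := by
  cases k with
  | zero => exact h.hx0
  | succ k =>
    intro h1
    have := h.hls k
    rw [phiE, h1, EReal.coe_add_top] at this
    exact absurd this (not_le.2 (EReal.coe_lt_top _))

theorem phiE_eq_s9 (h : NMPG f g γmax αmin αmax pmin x γ α p Φ) (k : ℕ) :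
    phiE f g (x k) = ((f (x k) + (g (x k)).toReal : ℝ) : EReal) := by
  rw [phiE, EReal.coe_add, EReal.coe_toReal (h.g_ne_top k) (h.hg_nebot _)]

theorem line_search (h : NMPG f g γmax αmin αmax pmin x γ α p Φ) (k : ℕ) :
    f (x (k + 1)) + (g (x (k + 1))).toReal ≤
      Φ k - (1 - α (k + 1)) / (2 * γ (k + 1)) * ‖x (k + 1) - x k‖ ^ 2 := by
  have := h.hls k
  rwa [h.phiE_eq_s9, EReal.coe_le_coe_iff] at this

theorem merit_succ (h : NMPG f g γmax αmin αmax pmin x γ α p Φ) (k : ℕ) :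
    Φ (k + 1) = (1 - p (k + 1)) * Φ k + p (k + 1) * (f (x (k + 1)) + (g (x (k + 1))).toReal) := by
  rw [h.hΦrec k, h.phiE_eq_s9, EReal.toReal_coe]

theorem sq_coeff_le (h : NMPG f g γmax αmin αmax pmin x γ α p Φ) (k : ℕ) :
    (1 - αmax) / (2 * γmax) * ‖x (k + 1) - x k‖ ^ 2 ≤
      (1 - α (k + 1)) / (2 * γ (k + 1)) * ‖x (k + 1) - x k‖ ^ 2 := by
  have h1 := (h.hαmem (k + 1)).2
  have h2 := h.hγpos (k + 1)
  have h3 := h.hγle (k + 1)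
  have h4 := h.hαmax
  gcongr
  linarith

theorem sq_coeff_pos (h : NMPG f g γmax αmin αmax pmin x γ α p Φ) :
    0 < (1 - αmax) / (2 * γmax) :=
  div_pos (by linarith [h.hαmax]) (by linarith [h.hγmax])

theorem merit_decrease (h : NMPG f g γmax αmin αmax pmin x γ α p Φ) (k : ℕ) :
    Φ (k + 1) ≤ Φ k - pmin * ((1 - αmax) / (2 * γmax) * ‖x (k + 1) - x k‖ ^ 2) := by
  have h1 := h.line_search k
  have h2 := h.sq_coeff_le k
  have h3 := (h.hpmem (k + 1)).1
  have h4 : 0 ≤ (1 - αmax) / (2 * γmax) * ‖x (k + 1) - x k‖ ^ 2 :=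
    mul_nonneg h.sq_coeff_pos.le (sq_nonneg _)
  rw [h.merit_succ k]
  nlinarith [h.hpmin]

theorem antitone_merit (h : NMPG f g γmax αmin αmax pmin x γ α p Φ) : Antitone Φ := by
  refine antitone_nat_of_succ_le fun k => (h.merit_decrease k).trans (sub_le_self _ ?_)
  exact mul_nonneg h.hpmin.le (mul_nonneg h.sq_coeff_pos.le (sq_nonneg _))

theorem objective_le_merit (h : NMPG f g γmax αmin αmax pmin x γ α p Φ) (k : ℕ) :
    f (x k) + (g (x k)).toReal ≤ Φ k := by
  cases k with
  | zero =>
    have := h.hΦ0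
    rw [h.phiE_eq_s9, EReal.coe_eq_coe_iff] at this
    exact this.ge
  | succ k =>
    have h1 := h.line_search k
    have h2 := h.sq_coeff_le k
    have h4 : 0 ≤ (1 - αmax) / (2 * γmax) * ‖x (k + 1) - x k‖ ^ 2 :=
      mul_nonneg h.sq_coeff_pos.le (sq_nonneg _)
    rw [h.merit_succ k]
    nlinarith [(h.hpmem (k + 1)).2]

theorem tendsto_norm_sub_s9 (h : NMPG f g γmax αmin αmax pmin x γ α p Φ) :
    Tendsto (fun k => ‖x (k + 1) - x k‖) atTop (𝓝 0) := by
  obtain ⟨m, hm⟩ := h.hφ_bdd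
  have hbdd : BddBelow (Set.range Φ) := by
    refine ⟨m, ?_⟩
    rintro _ ⟨k, rfl⟩
    have := hm (x k)
    rw [h.phiE_eq_s9, EReal.coe_le_coe_iff] at this
    exact this.trans (h.objective_le_merit k)
  have hlim := tendsto_atTop_ciInf h.antitone_merit hbdd
  have hdiff : Tendsto (fun k => Φ k - Φ (k + 1)) atTop (𝓝 0) := by
    simpa using hlim.sub (hlim.comp (tendsto_add_atTop_nat 1))
  have hc : 0 < pmin * ((1 - αmax) / (2 * γmax)) := mul_pos h.hpmin h.sq_coeff_pos
  have hsq : Tendsto (fun k => ‖x (k + 1) - x k‖ ^ 2) atTop (𝓝 0) := by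
    refine squeeze_zero (fun k => sq_nonneg _) (fun k => ?_)
      (by simpa using hdiff.div_const (pmin * ((1 - αmax) / (2 * γmax))))
    rw [le_div_iff₀ hc]
    linarith [h.merit_decrease k]
  simpa using hsq.sqrt

/-- The trial point of a rejected stepsize is close to the base point, relative to the stepsize. -/
theorem norm_sub_le_of_rejected (h : NMPG f g γmax αmin αmax pmin x γ α p Φ) {k : ℕ} {σ : ℝ}
    {y : X} (hσ : 0 < σ) (hy : ProxMin g (gradient f (x k)) (x k) σ y)
    (hrej : ((Φ k - (1 - αmin) / (2 * σ) * ‖y - x k‖ ^ 2 : ℝ) : EReal) < phiE f g y)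
    {s : Set X} (hs : Convex ℝ s) (hxs : x k ∈ s) (hys : y ∈ s) {C : ℝ}
    (hC : ∀ z ∈ s, ‖gradient f z - gradient f (x k)‖ ≤ C) :
    ‖y - x k‖ ≤ 2 * C / αmin * σ := by
  obtain ⟨hgy, h1⟩ := hy.le_toReal h.hg_nebot (h.g_ne_top k)
  rw [phiE, ← EReal.coe_toReal hgy (h.hg_nebot y), ← EReal.coe_add, EReal.coe_lt_coe_iff] at hrej
  have h2 := sub_inner_gradient_le h.hf hs hxs hys hC
  have h3 := h.objective_le_merit k
  simp only [sub_self, inner_zero_right, norm_zero, ne_eq, OfNat.ofNat_ne_zero,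
    not_false_eq_true, zero_pow, zero_div, add_zero] at h1
  have h4 : αmin / (2 * σ) * ‖y - x k‖ ^ 2 =
      ‖y - x k‖ ^ 2 / (2 * σ) - (1 - αmin) / (2 * σ) * ‖y - x k‖ ^ 2 := by ring
  have h5 : αmin / (2 * σ) * ‖y - x k‖ ^ 2 < C * ‖y - x k‖ := by linarith
  have hpos : 0 < ‖y - x k‖ := by
    refine (norm_nonneg _).lt_of_ne' fun h0 => ?_
    simp [h0] at h5
  have h6 : αmin / (2 * σ) * ‖y - x k‖ < C := by
    refine lt_of_mul_lt_mul_right ?_ hpos.le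
    linarith
  have hα := h.hαmin
  rw [div_mul_eq_mul_div, div_lt_iff₀ (by positivity)] at h6
  rw [div_mul_eq_mul_div, le_div_iff₀ hα]
  linarith

/-- Along a convergent subsequence the scaled displacements eventually become arbitrarily small. -/
theorem eventually_norm_sub_le (h : NMPG f g γmax αmin αmax pmin x γ α p Φ)
    {γmin βmin βmax : ℝ} (hγmin : 0 < γmin) (hβmin : 0 < βmin)
    (hββ : βmin ≤ βmax) (hβmax : βmax < 1) (hbt : Backtrack f g αmin γmin βmin βmax x γ Φ)
    {xstar : X} {ks : ℕ → ℕ} (hks : Tendsto ks atTop atTop)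
    (hx : Tendsto (fun j => x (ks j)) atTop (𝓝 xstar)) {η : ℝ} (hη : 0 < η) :
    ∀ᶠ j in atTop, ‖x (ks j + 1) - x (ks j)‖ ≤ η * γ (ks j + 1) := by
  have hα := h.hαmin
  obtain ⟨γ₀, hγ₀, m, hm⟩ := h.hg_proxbdd
  have hgrad : Continuous (gradient f) := h.hf.continuous_gradient_of_one
  set η' := η * βmin * αmin / 4 with hη'
  have hη'pos : 0 < η' := by positivity
  obtain ⟨δ, hδ, hball⟩ := Metric.continuousAt_iff.1 (hgrad.continuousAt (x := xstar)) η' hη'pos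
  obtain ⟨σ₀, hσ₀, hclose⟩ := exists_stepsize_norm_sub_lt h.hg_nebot hγ₀ hm
    (Φ 0 - (f xstar - 1)) (‖gradient f xstar‖ + 1) (‖xstar‖ + 1) (half_pos hδ)
  set c := min γmin (βmin * σ₀) with hc
  have hcpos : 0 < c := lt_min hγmin (by positivity)
  have e1 : ∀ᶠ j in atTop, ‖x (ks j + 1) - x (ks j)‖ < η * c :=
    (h.tendsto_norm_sub_s9.comp hks).eventually_lt_const (by positivity)
  have e2 : ∀ᶠ j in atTop, dist (x (ks j)) xstar < δ / 2 :=
    hx.eventually (Metric.ball_mem_nhds _ (half_pos hδ))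
  have e3 : ∀ᶠ j in atTop, ‖gradient f (x (ks j))‖ < ‖gradient f xstar‖ + 1 :=
    ((hgrad.tendsto xstar).comp hx).norm.eventually_lt_const (by linarith)
  have e4 : ∀ᶠ j in atTop, ‖x (ks j)‖ < ‖xstar‖ + 1 :=
    hx.norm.eventually_lt_const (by linarith)
  have e5 : ∀ᶠ j in atTop, f xstar - 1 < f (x (ks j)) :=
    ((h.hf.continuous.tendsto xstar).comp hx).eventually_const_lt (by linarith)
  filter_upwards [e1, e2, e3, e4, e5] with j h1 h2 h3 h4 h5
  set k := ks j
  have hγk := h.hγpos (k + 1)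
  rcases le_or_gt c (γ (k + 1)) with hle | hlt
  · exact h1.le.trans (by gcongr)
  rcases hbt k with hb | ⟨σ, y, hσ1, hσ2, hy, hrej⟩
  · exact absurd (hlt.trans_le (min_le_left _ _)) (not_lt.2 hb)
  have hγσ : γ (k + 1) < σ := by
    refine lt_of_lt_of_le ?_ hσ1
    rw [lt_div_iff₀ (hβmin.trans_le hββ)]
    nlinarith
  have hσ : 0 < σ := hγk.trans hγσ
  rw [le_div_iff₀ hβmin] at hσ2
  have hσlt : σ < σ₀ := by
    have := hlt.trans_le (min_le_right _ _)
    nlinarith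
  have hyx : ‖y - x k‖ < δ / 2 := by
    refine hclose σ hσ hσlt _ _ _ h3.le h4.le (h.g_ne_top k) ?_ hy
    linarith [h.objective_le_merit k, h.antitone_merit (Nat.zero_le k)]
  have hxs : x k ∈ Metric.ball xstar δ := by
    rw [Metric.mem_ball]
    linarith
  have hys : y ∈ Metric.ball xstar δ := by
    rw [Metric.mem_ball]
    rw [← dist_eq_norm] at hyx
    linarith [dist_triangle y (x k) xstar]
  have hosc (z : X) (hz : z ∈ Metric.ball xstar δ) :
      ‖gradient f z - gradient f (x k)‖ ≤ 2 * η' := by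
    rw [← dist_eq_norm]
    linarith [hball hz, hball hxs,
      dist_triangle_right (gradient f z) (gradient f (x k)) (gradient f xstar)]
  calc ‖x (k + 1) - x k‖ ≤ ‖y - x k‖ :=
        (h.hstep k).norm_sub_le h.hg_nebot hγk hγσ hy (h.g_ne_top _)
    _ ≤ 2 * (2 * η') / αmin * σ :=
        h.norm_sub_le_of_rejected hσ hy hrej (convex_ball _ _) hxs hys hosc
    _ = η * (σ * βmin) := by rw [hη']; field_simp; ring
    _ ≤ η * γ (k + 1) := by gcongr

end NMPG

theorem stmt_9 (f : X → ℝ) (g : X → EReal) (γmax αmin αmax pmin : ℝ)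
    (x : ℕ → X) (γ α p : ℕ → ℝ) (Φ : ℕ → ℝ)
    (h : NMPG f g γmax αmin αmax pmin x γ α p Φ)
    (γmin βmin βmax : ℝ) (hγmin : 0 < γmin) (hβmin : 0 < βmin)
    (hββ : βmin ≤ βmax) (hβmax : βmax < 1)
    (hbt : Backtrack f g αmin γmin βmin βmax x γ Φ)
    (ε : ℝ) (hε : 0 < ε)
    (hacc : ∃ (xstar : X) (ks : ℕ → ℕ), StrictMono ks ∧
      Tendsto (fun j => x (ks j)) atTop (𝓝 xstar)) :
    ∃ k : ℕ, 1 ≤ k ∧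
      ‖(1 / γ k) • (x (k - 1) - x k) - gradient f (x (k - 1)) + gradient f (x k)‖ ≤ ε := by
  obtain ⟨xstar, ks, hks, hx⟩ := hacc
  have hks' := hks.tendsto_atTop
  have hgrad : Continuous (gradient f) := h.hf.continuous_gradient_of_one
  have hx' : Tendsto (fun j => x (ks j + 1)) atTop (𝓝 xstar) := by
    have := (tendsto_zero_iff_norm_tendsto_zero.2 (h.tendsto_norm_sub_s9)).comp hks'
    simpa using hx.add this
  have hdiff : Tendsto (fun j => ‖gradient f (x (ks j + 1)) - gradient f (x (ks j))‖)
      atTop (𝓝 0) := by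
    simpa using (((hgrad.tendsto xstar).comp hx').sub ((hgrad.tendsto xstar).comp hx)).norm
  obtain ⟨j, h1, h2⟩ := ((h.eventually_norm_sub_le hγmin hβmin hββ hβmax hbt hks' hx
    (half_pos hε)).and (hdiff.eventually_lt_const (half_pos hε))).exists
  refine ⟨ks j + 1, Nat.le_add_left _ _, ?_⟩
  have hγ := h.hγpos (ks j + 1)
  have h3 : ‖(1 / γ (ks j + 1)) • (x (ks j) - x (ks j + 1))‖ ≤ ε / 2 := by
    rw [norm_smul, norm_sub_rev, Real.norm_of_nonneg (by positivity), one_div_mul_eq_div,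
      div_le_iff₀ hγ]
    exact h1
  rw [Nat.add_sub_cancel, sub_add, sub_eq_add_neg, neg_sub]
  linarith [norm_add_le ((1 / γ (ks j + 1)) • (x (ks j) - x (ks j + 1)))
    (gradient f (x (ks j + 1)) - gradient f (x (ks j)))]
end
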